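/- Let S be the Sierpinski gasket with natural measure μ and s = log 3/log 2. Assume μ gives zero measure to every sphere and to the boundary of every feasible open set (known facts for self-similar measures). Let m and M be the infimum and supremum of θ_μ^s(x, d) over all typical balls B(x, d) (x ∈ S, d > 0, B(x, d) ⊆ O for some feasible open set O), and assume m and M are attained by typical balls (the P^s- and C^s-exactness of S, known from prior work). Then the asymptotic spectrum of μ over all of S is the union of two closed intervals: Spec(μ, S) = [θ̲_μ^s(z₀), θ̄_μ^s(z₀)] ∪ [m, M]. -/

import Mathlib

open MeasureTheory Filter Topology
open scoped ENNReal

noncomputable section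

/-- The point `(a, b)` of the Euclidean plane. -/
def pt (a b : ℝ) : EuclideanSpace ℝ (Fin 2) :=
  (WithLp.equiv 2 (Fin 2 → ℝ)).symm ![a, b]

/-- The three contracting similarities generating the Sierpinski gasket. -/
def sierf : Fin 3 → EuclideanSpace ℝ (Fin 2) → EuclideanSpace ℝ (Fin 2) :=
  ![fun v => (1/2 : ℝ) • v,
    fun v => (1/2 : ℝ) • v + pt (1/2) 0,
    fun v => (1/2 : ℝ) • v + pt (1/4) (Real.sqrt 3 / 4)]

/-- The vertices `z₀, z₁, z₂` of the Sierpinski gasket. -/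
def vert : Fin 3 → EuclideanSpace ℝ (Fin 2) :=
  ![pt 0 0, pt 1 0, pt (1/2) (Real.sqrt 3 / 2)]

/-- The similarity dimension `s = log 3 / log 2` of the Sierpinski gasket. -/
def sierDim : ℝ := Real.log 3 / Real.log 2

/-- The `s`-density `θ_μ^s(x, d) = μ(B(x,d)) / (2d)^s` of the closed ball `B(x, d)`. -/
def sdens (μ : Measure (EuclideanSpace ℝ (Fin 2))) (s : ℝ)
    (x : EuclideanSpace ℝ (Fin 2)) (d : ℝ) : ℝ≥0∞ :=
  μ (Metric.closedBall x d) / ENNReal.ofReal ((2 * d) ^ s)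

/-- The asymptotic spectrum `Spec(μ, x)`. -/
def specAt (μ : Measure (EuclideanSpace ℝ (Fin 2))) (s : ℝ)
    (x : EuclideanSpace ℝ (Fin 2)) : Set ℝ≥0∞ :=
  {L | ∃ d : ℕ → ℝ, (∀ k, 0 < d k) ∧ Tendsto d atTop (nhds 0) ∧
    Tendsto (fun k => sdens μ s x (d k)) atTop (nhds L)}

/-- `O` is a feasible open set for the Sierpinski system. -/
def feasibleFor (S O : Set (EuclideanSpace ℝ (Fin 2))) : Prop :=
  IsOpen O ∧ O.Nonempty ∧ (∀ i : Fin 3, sierf i '' O ⊆ O) ∧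
  (∀ i j : Fin 3, i ≠ j → Disjoint (sierf i '' O) (sierf j '' O)) ∧ (O ∩ S).Nonempty

/-- The set of `s`-densities of typical balls of the Sierpinski gasket. -/
def typDens (μ : Measure (EuclideanSpace ℝ (Fin 2)))
    (S : Set (EuclideanSpace ℝ (Fin 2))) : Set ℝ≥0∞ :=
  {t | ∃ x ∈ S, ∃ d : ℝ, 0 < d ∧ (∃ O, feasibleFor S O ∧ Metric.closedBall x d ⊆ O) ∧
    t = sdens μ sierDim x d}

local notation "Plane" => EuclideanSpace ℝ (Fin 2)

/-! ### Limits along sequences of radii -/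

theorem exists_seq_tendsto_of_frequently {g : ℝ → ℝ≥0∞} {L : ℝ≥0∞}
    (h : ∀ U ∈ 𝓝 L, ∃ᶠ d in 𝓝[>] (0 : ℝ), g d ∈ U) :
    ∃ d : ℕ → ℝ, (∀ k, 0 < d k) ∧ Tendsto d atTop (nhds 0) ∧
      Tendsto (fun k => g (d k)) atTop (nhds L) := by
  have hne : (𝓝[>] (0 : ℝ) ⊓ comap g (𝓝 L)).NeBot := by
    rw [inf_neBot_iff]
    rintro V hV W ⟨U, hU, hUW⟩
    obtain ⟨d, hdV, hdU⟩ := frequently_iff.1 (h U hU) hV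
    exact ⟨d, hdV, hUW hdU⟩
  obtain ⟨d, hd⟩ := exists_seq_tendsto (𝓝[>] (0 : ℝ) ⊓ comap g (𝓝 L))
  rw [tendsto_inf, tendsto_comap_iff, tendsto_nhdsWithin_iff] at hd
  obtain ⟨⟨hd0, hdpos⟩, hdL⟩ := hd
  obtain ⟨N, hN⟩ := eventually_atTop.1 hdpos
  exact ⟨fun k => d (k + N), fun k => hN _ (by omega), (tendsto_add_atTop_iff_nat N).2 hd0,
    (tendsto_add_atTop_iff_nat (f := fun k => g (d k)) N).2 hdL⟩

theorem setOf_seq_limits_eq_Icc_liminf_limsup {g : ℝ → ℝ≥0∞} (hg : ContinuousOn g (Set.Ioi 0)) :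
    {L | ∃ d : ℕ → ℝ, (∀ k, 0 < d k) ∧ Tendsto d atTop (nhds 0) ∧
      Tendsto (fun k => g (d k)) atTop (nhds L)} =
      Set.Icc (liminf g (𝓝[>] 0)) (limsup g (𝓝[>] 0)) := by
  ext L
  constructor
  · rintro ⟨d, hpos, hd, hL⟩
    have hd' : Tendsto d atTop (𝓝[>] 0) :=
      tendsto_nhdsWithin_iff.2 ⟨hd, Eventually.of_forall hpos⟩
    have hL' : Tendsto g (map d atTop) (𝓝 L) := tendsto_map'_iff.2 hL
    exact ⟨hL'.liminf_eq ▸ liminf_le_liminf_of_le hd',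
      hL'.limsup_eq ▸ limsup_le_limsup_of_le hd'⟩
  · rintro ⟨h₁, h₂⟩
    refine exists_seq_tendsto_of_frequently fun U hU hcon => ?_
    obtain ⟨δ, hδ, hδU⟩ := mem_nhdsGT_iff_exists_Ioo_subset.1 hcon
    have hδ' : Set.Ioo 0 δ ∈ 𝓝[>] (0 : ℝ) := Ioo_mem_nhdsGT hδ
    have hLU : L ∈ U := mem_of_mem_nhds hU
    have himg : (g '' Set.Ioo 0 δ).OrdConnected :=
      (isPreconnected_Ioo.image g (hg.mono fun d hd => hd.1)).ordConnected
    have hLg : L ∉ g '' Set.Ioo 0 δ := by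
      rintro ⟨d, hd, rfl⟩
      exact hδU hd hLU
    by_cases hlow : ∃ d ∈ Set.Ioo 0 δ, g d < L
    · obtain ⟨d₀, hd₀, hlt⟩ := hlow
      obtain ⟨l, hl, hlU⟩ := exists_Ioc_subset_of_mem_nhds hU ⟨_, hlt⟩
      refine (h₂.trans (limsup_le_of_le (by isBoundedDefault) ?_)).not_gt hl
      filter_upwards [hδ'] with d hd
      by_contra! hd'
      have hdL : ¬ g d ≤ L := fun hle => hδU hd (hlU ⟨hd', hle⟩)
      exact hLg (himg.out ⟨d₀, hd₀, rfl⟩ ⟨d, hd, rfl⟩ ⟨hlt.le, (not_le.1 hdL).le⟩)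
    · push Not at hlow
      have hgt : ∀ d ∈ Set.Ioo 0 δ, L < g d := fun d hd =>
        (hlow d hd).lt_of_ne fun h => hLg ⟨d, hd, h.symm⟩
      obtain ⟨u, hu, huU⟩ := exists_Ico_subset_of_mem_nhds hU
        ⟨_, hgt (δ / 2) ⟨half_pos hδ, half_lt_self hδ⟩⟩
      refine ((le_liminf_of_le (by isBoundedDefault) ?_).trans h₁).not_gt hu
      filter_upwards [hδ'] with d hd
      by_contra! hd'
      exact hδU hd (huU ⟨(hgt d hd).le, hd'⟩)

/-! ### The generating similarities -/

theorem sierf_eq (i : Fin 3) (v : Plane) : sierf i v = (1 / 2 : ℝ) • (v + vert i) := by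
  fin_cases i <;> ext k <;> fin_cases k <;> simp [sierf, vert, pt] <;> ring

theorem sierf_two_smul_sub (i : Fin 3) (v : Plane) : sierf i ((2 : ℝ) • v - vert i) = v := by
  rw [sierf_eq]; module

theorem two_smul_sierf_sub (i : Fin 3) (v : Plane) : (2 : ℝ) • sierf i v - vert i = v := by
  rw [sierf_eq]; module

theorem dist_sierf (i : Fin 3) (u v : Plane) : dist (sierf i u) (sierf i v) = dist u v / 2 := by
  rw [sierf_eq, sierf_eq, dist_smul₀, dist_add_right]
  norm_num
  ring

theorem continuous_sierf (i : Fin 3) : Continuous (sierf i) := by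
  rw [funext (sierf_eq i)]; fun_prop

theorem sierf_preimage_closedBall (i : Fin 3) (x : Plane) (d : ℝ) :
    sierf i ⁻¹' Metric.closedBall x d = Metric.closedBall ((2 : ℝ) • x - vert i) (2 * d) := by
  ext v
  have h := dist_sierf i v ((2 : ℝ) • x - vert i)
  rw [sierf_two_smul_sub] at h
  rw [Set.mem_preimage, Metric.mem_closedBall, Metric.mem_closedBall, h]
  constructor <;> intro _ <;> linarith

theorem closedBall_sierf_subset {i : Fin 3} {x : Plane} {d : ℝ} {O : Set Plane}
    (hO : sierf i '' O ⊆ O) (h : Metric.closedBall x d ⊆ O) :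
    Metric.closedBall (sierf i x) (d / 2) ⊆ O := by
  intro v hv
  rw [← sierf_two_smul_sub i v] at hv ⊢
  refine hO ⟨_, h ?_, rfl⟩
  rw [Metric.mem_closedBall, dist_sierf] at hv
  rw [Metric.mem_closedBall]
  linarith

theorem two_rpow_sierDim : (2 : ℝ) ^ sierDim = 3 :=
  Real.rpow_logb (b := 2) (x := 3) (by norm_num) (by norm_num) (by norm_num)

/-! ### Points of the attractor -/

section Attractor

variable {S : Set (EuclideanSpace ℝ (Fin 2))}

theorem sierf_mem_attractor (hSattr : S = ⋃ i, sierf i '' S) (i : Fin 3) {x : Plane}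
    (hx : x ∈ S) : sierf i x ∈ S := by
  rw [hSattr]; exact Set.mem_iUnion.2 ⟨i, x, hx, rfl⟩

theorem exists_sierf_eq_of_mem_attractor (hSattr : S = ⋃ i, sierf i '' S) {x : Plane}
    (hx : x ∈ S) : ∃ i, ∃ y ∈ S, sierf i y = x := by
  rw [hSattr] at hx; exact Set.mem_iUnion.1 hx

/-- Every nonempty set mapped into itself by the similarities accumulates on the attractor. -/
theorem attractor_subset_closure (hSc : IsCompact S) (hSattr : S = ⋃ i, sierf i '' S)
    {A : Set Plane} (hA : A.Nonempty) (hmaps : ∀ i, ∀ a ∈ A, sierf i a ∈ A) :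
    S ⊆ closure A := by
  obtain ⟨a₀, ha₀⟩ := hA
  obtain ⟨C, hC⟩ := hSc.isBounded.subset_closedBall a₀
  have key : ∀ n : ℕ, ∀ y ∈ S, ∃ a ∈ A, dist y a ≤ C * (1 / 2) ^ n := by
    intro n
    induction n with
    | zero => intro y hy; exact ⟨a₀, ha₀, by simpa using hC hy⟩
    | succ n ih =>
      intro y hy
      obtain ⟨i, z, hz, rfl⟩ := exists_sierf_eq_of_mem_attractor hSattr hy
      obtain ⟨a, ha, hza⟩ := ih z hz
      refine ⟨sierf i a, hmaps i a ha, ?_⟩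
      rw [dist_sierf, pow_succ]
      linarith
  intro y hy
  rw [Metric.mem_closure_iff]
  intro ε hε
  have ht : Tendsto (fun n : ℕ => C * (1 / 2 : ℝ) ^ n) atTop (𝓝 (C * 0)) :=
    (tendsto_pow_atTop_nhds_zero_of_lt_one (by norm_num) (by norm_num)).const_mul C
  rw [mul_zero] at ht
  obtain ⟨n, hn⟩ := (ht.eventually_lt_const hε).exists
  obtain ⟨a, ha, hya⟩ := key n y hy
  exact ⟨a, ha, hya.trans_lt hn⟩

theorem vert_zero_mem_attractor (hSc : IsCompact S) (hSne : S.Nonempty)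
    (hSattr : S = ⋃ i, sierf i '' S) : vert 0 ∈ S := by
  obtain ⟨x, hx⟩ := hSne
  have hmem : ∀ n : ℕ, ((1 / 2 : ℝ) ^ n) • x ∈ S := by
    intro n
    induction n with
    | zero => simpa using hx
    | succ n ih =>
      have := sierf_mem_attractor hSattr 0 ih
      rwa [show sierf 0 (((1 / 2 : ℝ) ^ n) • x) = ((1 / 2 : ℝ) ^ (n + 1)) • x by
        rw [pow_succ', mul_smul]; rfl] at this
  have ht : Tendsto (fun n : ℕ => ((1 / 2 : ℝ) ^ n) • x) atTop (𝓝 ((0 : ℝ) • x)) :=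
    (tendsto_pow_atTop_nhds_zero_of_lt_one (by norm_num) (by norm_num)).smul_const x
  have h0 : vert 0 = (0 : ℝ) • x := by
    ext k; fin_cases k <;> simp [vert, pt]
  rw [h0]
  exact hSc.isClosed.mem_of_tendsto ht (Eventually.of_forall hmem)

theorem linear_le_on_attractor (hSc : IsCompact S) (hSattr : S = ⋃ i, sierf i '' S)
    (l : Plane →L[ℝ] ℝ) {c : ℝ} (hl : ∀ i, l (vert i) ≤ c) {x : Plane} (hx : x ∈ S) :
    l x ≤ c := by
  obtain ⟨p, hp, hmax⟩ := hSc.exists_isMaxOn ⟨x, hx⟩ l.continuous.continuousOn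
  obtain ⟨i, q, hq, rfl⟩ := exists_sierf_eq_of_mem_attractor hSattr hp
  have h1 := hmax hq
  have h2 := hmax hx
  have h3 := hl i
  simp only [Set.mem_ofPred_eq, sierf_eq, map_smul, map_add, smul_eq_mul] at h1 h2
  linarith

/-- The open regular hexagon having the vertices of the gasket as alternate vertices. -/
def hexagon : Set (EuclideanSpace ℝ (Fin 2)) :=
  {v | (0 < v 0 ∧ v 0 < 1) ∧ (0 < v 0 + √3 * v 1 ∧ v 0 + √3 * v 1 < 2) ∧
    (-1 < √3 * v 1 - v 0 ∧ √3 * v 1 - v 0 < 1)}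

theorem isOpen_hexagon : IsOpen hexagon := by
  unfold hexagon
  simp only [Set.ofPred_and]
  refine ((isOpen_lt ?_ ?_).inter (isOpen_lt ?_ ?_)).inter
    (((isOpen_lt ?_ ?_).inter (isOpen_lt ?_ ?_)).inter
      ((isOpen_lt ?_ ?_).inter (isOpen_lt ?_ ?_))) <;> fun_prop

theorem sierf_coord_zero (i : Fin 3) (v : Plane) :
    sierf i v 0 = v 0 / 2 + ![0, 1 / 2, 1 / 4] i := by
  fin_cases i <;> simp [sierf, pt] <;> ring

theorem sqrt_three_mul_sierf_coord_one (i : Fin 3) (v : Plane) :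
    √3 * sierf i v 1 = √3 * v 1 / 2 + ![0, 0, 3 / 4] i := by
  have h : √3 * √3 = 3 := Real.mul_self_sqrt (by norm_num)
  fin_cases i <;> simp [sierf, pt] <;> linarith

theorem feasibleFor_hexagon (h : (hexagon ∩ S).Nonempty) : feasibleFor S hexagon := by
  refine ⟨isOpen_hexagon, h.mono Set.inter_subset_left, ?_, ?_, h⟩
  · rintro i _ ⟨v, ⟨⟨h1, h2⟩, ⟨h3, h4⟩, h5, h6⟩, rfl⟩
    simp only [hexagon, Set.mem_ofPred_eq, sierf_coord_zero, sqrt_three_mul_sierf_coord_one]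
    fin_cases i <;> simp <;> refine ⟨⟨?_, ?_⟩, ⟨?_, ?_⟩, ?_, ?_⟩ <;> linarith
  · intro i j hij
    rw [Set.disjoint_left]
    rintro _ ⟨u, ⟨⟨h1, h2⟩, ⟨h3, h4⟩, h5, h6⟩, rfl⟩ ⟨v, ⟨⟨k1, k2⟩, ⟨k3, k4⟩, k5, k6⟩, huv⟩
    have e0 : sierf j v 0 = sierf i u 0 := by rw [huv]
    have e1 : √3 * sierf j v 1 = √3 * sierf i u 1 := by rw [huv]
    rw [sierf_coord_zero, sierf_coord_zero] at e0
    rw [sqrt_three_mul_sierf_coord_one, sqrt_three_mul_sierf_coord_one] at e1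
    fin_cases i <;> fin_cases j <;> simp at hij e0 e1 <;> linarith

theorem mem_hexagon_of_ne_vert (hSc : IsCompact S) (hSattr : S = ⋃ i, sierf i '' S)
    {x : Plane} (hx : x ∈ S) (hv : ∀ i, x ≠ vert i) : x ∈ hexagon := by
  have h3 : √3 * √3 = 3 := Real.mul_self_sqrt (by norm_num)
  have h3pos : 0 < √3 := by positivity
  have hbound : ∀ a b c : ℝ, 0 ≤ c → a ≤ c → a / 2 + b * (3 / 2) ≤ c →
      a * x 0 + b * (√3 * x 1) ≤ c := by
    intro a b c hc ha hab
    have := linear_le_on_attractor hSc hSattr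
      (a • EuclideanSpace.proj (0 : Fin 2) + (b * √3) • EuclideanSpace.proj (1 : Fin 2))
      (c := c) ?_ hx
    · simpa [mul_assoc] using this
    · intro i
      fin_cases i <;> simp [vert, pt] <;> nlinarith
  have b1 := hbound 0 (-1) 0 (by norm_num) (by norm_num) (by norm_num)
  have b2 := hbound (-3) 1 0 (by norm_num) (by norm_num) (by norm_num)
  have b3 := hbound 3 1 3 (by norm_num) (by norm_num) (by norm_num)
  have hext : ∀ i : Fin 3, x 0 = ![0, 1, 1 / 2] i → √3 * x 1 = ![0, 0, 3 / 2] i → False := by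
    intro i e0 e1
    apply hv i
    have e1' : 3 * x 1 = √3 * ![0, 0, 3 / 2] i := by rw [← e1, ← mul_assoc, h3]
    ext k
    fin_cases k
    · fin_cases i <;> simpa [vert, pt] using e0
    · fin_cases i <;> simp [vert, pt] at e1' ⊢ <;> linarith
  have n0 := hext 0
  have n1 := hext 1
  have n2 := hext 2
  simp only [Matrix.cons_val] at n0 n1 n2
  refine ⟨⟨?_, ?_⟩, ⟨?_, ?_⟩, ?_, ?_⟩ <;> by_contra! hcon
  · exact n0 (by linarith) (by linarith)
  · exact n1 (by linarith) (by linarith)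
  · exact n0 (by linarith) (by linarith)
  · exact n2 (by linarith) (by linarith)
  · exact n1 (by linarith) (by linarith)
  · exact n2 (by linarith) (by linarith)

end Attractor

/-! ### The measure of balls -/

section Measure

variable {S : Set (EuclideanSpace ℝ (Fin 2))} {μ : Measure (EuclideanSpace ℝ (Fin 2))}

theorem measure_closedBall_eq_sum
    (hinv : μ = (3 : ℝ≥0∞)⁻¹ • (μ.map (sierf 0) + μ.map (sierf 1) + μ.map (sierf 2)))
    (x : Plane) (d : ℝ) :
    μ (Metric.closedBall x d) =
      3⁻¹ * ∑ i, μ (Metric.closedBall ((2 : ℝ) • x - vert i) (2 * d)) := by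
  have hmap : ∀ i, μ.map (sierf i) (Metric.closedBall x d) =
      μ (Metric.closedBall ((2 : ℝ) • x - vert i) (2 * d)) := fun i => by
    rw [Measure.map_apply (continuous_sierf i).measurable measurableSet_closedBall,
      sierf_preimage_closedBall]
  conv_lhs => rw [hinv]
  simp [hmap, Fin.sum_univ_three, mul_add]

theorem continuous_measure_closedBall [IsFiniteMeasure μ]
    (hsph : ∀ (z : Plane) (ρ : ℝ), μ (Metric.sphere z ρ) = 0) :
    Continuous fun p : Plane × ℝ => μ (Metric.closedBall p.1 p.2) := by
  rw [continuous_iff_continuousAt]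
  rintro ⟨x, d⟩
  refine tendsto_measure_of_ae_tendsto_indicator (𝓝 (x, d)) measurableSet_closedBall
    (fun p => measurableSet_closedBall) MeasurableSet.univ (measure_ne_top μ _)
    (Eventually.of_forall fun p => Set.subset_univ _) ?_
  have hae : ∀ᵐ y ∂μ, y ∉ Metric.sphere x d := measure_eq_zero_iff_ae_notMem.1 (hsph x d)
  filter_upwards [hae] with y hy
  have hc : Continuous fun p : Plane × ℝ => dist y p.1 := by fun_prop
  rcases lt_or_gt_of_ne (show dist y x ≠ d from hy) with h | h
  · filter_upwards [hc.continuousAt.eventually_lt continuous_snd.continuousAt h] with p hp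
    simp only [Metric.mem_closedBall]
    exact iff_of_true hp.le h.le
  · filter_upwards [continuous_snd.continuousAt.eventually_lt hc.continuousAt h] with p hp
    simp only [Metric.mem_closedBall]
    exact iff_of_false (not_le.2 hp) (not_le.2 h)

theorem continuousOn_sdens [IsFiniteMeasure μ]
    (hsph : ∀ (z : Plane) (ρ : ℝ), μ (Metric.sphere z ρ) = 0) (s : ℝ) :
    ContinuousOn (fun p : Plane × ℝ => sdens μ s p.1 p.2) {p | 0 < p.2} := by
  intro p hp
  have hp' : 0 < 2 * p.2 := mul_pos two_pos hp
  refine ContinuousAt.continuousWithinAt ?_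
  refine ENNReal.Tendsto.div (continuous_measure_closedBall hsph).continuousAt
    (Or.inr (ENNReal.ofReal_pos.2 (Real.rpow_pos_of_pos hp' s)).ne') ?_
    (Or.inr (measure_ne_top μ _))
  refine (ENNReal.continuous_ofReal.tendsto _).comp ?_
  exact ContinuousAt.rpow (by fun_prop) continuousAt_const (Or.inl hp'.ne')

/-- Densities of balls inside a feasible open set are invariant under the similarities. -/
theorem sdens_sierf (hSc : IsCompact S) (hSattr : S = ⋃ i, sierf i '' S)
    (hsupp : μ Sᶜ = 0)
    (hinv : μ = (3 : ℝ≥0∞)⁻¹ • (μ.map (sierf 0) + μ.map (sierf 1) + μ.map (sierf 2)))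
    {O : Set Plane} (hO : feasibleFor S O) {x : Plane} {d : ℝ} (hd : 0 < d)
    (hball : Metric.closedBall x d ⊆ O) (i : Fin 3) :
    sdens μ sierDim (sierf i x) (d / 2) = sdens μ sierDim x d := by
  obtain ⟨hopen, hne, hmaps, hdisj, -⟩ := hO
  have hSO : S ⊆ closure O :=
    attractor_subset_closure hSc hSattr hne fun i a ha => hmaps i ⟨a, ha, rfl⟩
  have hzero : ∀ j, j ≠ i →
      μ (Metric.closedBall ((2 : ℝ) • sierf i x - vert j) (2 * (d / 2))) = 0 := by
    intro j hj
    refine measure_mono_null (t := Sᶜ) (fun v hv hvS => ?_) hsupp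
    rw [← sierf_preimage_closedBall, Set.mem_preimage] at hv
    have hv' : (2 : ℝ) • sierf j v - vert i ∈ O := by
      apply hball
      rw [← sierf_two_smul_sub i (sierf j v), Metric.mem_closedBall, dist_sierf] at hv
      rw [Metric.mem_closedBall]
      linarith
    have hcont : Continuous fun u => (2 : ℝ) • sierf j u - vert i :=
      ((continuous_sierf j).const_smul (2 : ℝ)).sub continuous_const
    obtain ⟨u, hu, huO⟩ := mem_closure_iff.1 (hSO hvS) _ (hopen.preimage hcont) hv'
    exact Set.disjoint_left.1 (hdisj j i hj) ⟨u, huO, rfl⟩ ⟨_, hu, sierf_two_smul_sub i _⟩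
  have hμ : μ (Metric.closedBall (sierf i x) (d / 2)) = 3⁻¹ * μ (Metric.closedBall x d) := by
    rw [measure_closedBall_eq_sum hinv,
      Finset.sum_eq_single i (fun j _ hj => hzero j hj) (by simp), two_smul_sierf_sub,
      mul_div_cancel₀ d two_ne_zero]
  have hpow : ENNReal.ofReal ((2 * d) ^ sierDim) =
      3 * ENNReal.ofReal ((2 * (d / 2)) ^ sierDim) := by
    rw [mul_div_cancel₀ d two_ne_zero, Real.mul_rpow two_pos.le hd.le, two_rpow_sierDim,
      ENNReal.ofReal_mul (by norm_num), ENNReal.ofReal_ofNat]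
  rw [sdens, sdens, hμ, hpow, ENNReal.div_eq_inv_mul, ENNReal.div_eq_inv_mul,
    ENNReal.mul_inv (Or.inl (by norm_num)) (Or.inl (by norm_num))]
  ring

/-- The rotation permuting the vertices of the gasket cyclically. -/
def rotVert (v : EuclideanSpace ℝ (Fin 2)) : EuclideanSpace ℝ (Fin 2) :=
  pt (1 - v 0 / 2 - √3 / 2 * v 1) (√3 / 2 * v 0 - v 1 / 2)

theorem rotVert_vert (i : Fin 3) : rotVert (vert i) = vert (i + 1) := by
  have h : √3 * √3 = 3 := Real.mul_self_sqrt (by norm_num)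
  fin_cases i <;> ext k <;> fin_cases k <;> simp [rotVert, vert, pt] <;> linarith

theorem rotVert_two_smul_sub (i : Fin 3) (v : Plane) :
    rotVert ((2 : ℝ) • v - vert i) = (2 : ℝ) • rotVert v - vert (i + 1) := by
  rw [← rotVert_vert]
  ext k
  fin_cases k <;> simp [rotVert, pt] <;> ring

theorem dist_rotVert (u v : Plane) : dist (rotVert u) (rotVert v) = dist u v := by
  have h : √3 ^ 2 = 3 := Real.sq_sqrt (by norm_num)
  rw [EuclideanSpace.dist_eq, EuclideanSpace.dist_eq]
  congr 1
  simp only [Fin.sum_univ_two, Real.dist_eq, sq_abs]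
  simp [rotVert, pt]
  linear_combination ((u 0 - v 0) ^ 2 / 4 + (u 1 - v 1) ^ 2 / 4) * h

theorem measure_closedBall_le_rotVert [IsProbabilityMeasure μ] (hSc : IsCompact S)
    (hsupp : μ Sᶜ = 0)
    (hinv : μ = (3 : ℝ≥0∞)⁻¹ • (μ.map (sierf 0) + μ.map (sierf 1) + μ.map (sierf 2)))
    (hsph : ∀ (z : Plane) (ρ : ℝ), μ (Metric.sphere z ρ) = 0) (x : Plane) (d : ℝ) :
    μ (Metric.closedBall x d) ≤ μ (Metric.closedBall (rotVert x) d) := by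
  obtain ⟨C₁, hC₁⟩ := hSc.isBounded.subset_closedBall (vert 0)
  obtain ⟨C₂, hC₂⟩ := hSc.isBounded.subset_closedBall (rotVert (vert 0))
  have key : ∀ n : ℕ, ∀ x d, μ (Metric.closedBall x d) ≤
      μ (Metric.closedBall (rotVert x) (d + (C₁ + C₂) * (1 / 2) ^ n)) := by
    intro n
    induction n with
    | zero =>
      intro x d
      by_cases hx : ∃ y ∈ S, y ∈ Metric.closedBall x d
      · obtain ⟨y, hy, hyx⟩ := hx
        have hsub : S ⊆ Metric.closedBall (rotVert x) (d + (C₁ + C₂) * (1 / 2) ^ 0) := by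
          intro z hz
          have h1 := hC₂ hz
          have h2 := hC₁ hy
          rw [Metric.mem_closedBall] at h1 h2 hyx ⊢
          have t1 := dist_triangle z (rotVert (vert 0)) (rotVert x)
          have t2 := dist_triangle (vert 0) y x
          rw [dist_rotVert] at t1
          rw [dist_comm y (vert 0)] at h2
          linarith
        have hS : ∀ᵐ z ∂μ, z ∈ S := mem_ae_iff.2 hsupp
        exact measure_mono_ae (hS.mono fun z hz _ => hsub hz)
      · push Not at hx
        rw [measure_mono_null (t := Sᶜ) (fun y hy hyS => hx y hyS hy) hsupp]
        exact zero_le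
    | succ n ih =>
      intro x d
      rw [measure_closedBall_eq_sum hinv x, measure_closedBall_eq_sum hinv (rotVert x),
        ← Equiv.sum_comp (Equiv.addRight (1 : Fin 3)) fun i =>
          μ (Metric.closedBall ((2 : ℝ) • rotVert x - vert i) _)]
      gcongr 3⁻¹ * ?_
      refine Finset.sum_le_sum fun i _ => (ih _ _).trans_eq ?_
      rw [rotVert_two_smul_sub, Equiv.coe_addRight]
      congr 2
      ring
  have ht : Tendsto (fun n : ℕ => (rotVert x, d + (C₁ + C₂) * (1 / 2 : ℝ) ^ n)) atTop
      (𝓝 (rotVert x, d + (C₁ + C₂) * 0)) :=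
    tendsto_const_nhds.prodMk_nhds (((tendsto_pow_atTop_nhds_zero_of_lt_one (by norm_num)
      (by norm_num)).const_mul _).const_add d)
  rw [mul_zero, add_zero] at ht
  have hlim := ((continuous_measure_closedBall hsph).tendsto (rotVert x, d)).comp ht
  exact ge_of_tendsto' hlim fun n => key n x d

theorem sdens_vert [IsProbabilityMeasure μ] (hSc : IsCompact S) (hsupp : μ Sᶜ = 0)
    (hinv : μ = (3 : ℝ≥0∞)⁻¹ • (μ.map (sierf 0) + μ.map (sierf 1) + μ.map (sierf 2)))
    (hsph : ∀ (z : Plane) (ρ : ℝ), μ (Metric.sphere z ρ) = 0) (s : ℝ) (i : Fin 3) (d : ℝ) :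
    sdens μ s (vert i) d = sdens μ s (vert 0) d := by
  have hle : ∀ i, μ (Metric.closedBall (vert i) d) ≤ μ (Metric.closedBall (vert (i + 1)) d) :=
    fun i => rotVert_vert i ▸ measure_closedBall_le_rotVert hSc hsupp hinv hsph (vert i) d
  have h0 : μ (Metric.closedBall (vert 0) d) ≤ μ (Metric.closedBall (vert 1) d) := hle 0
  have h1 : μ (Metric.closedBall (vert 1) d) ≤ μ (Metric.closedBall (vert 2) d) := hle 1
  have h2 : μ (Metric.closedBall (vert 2) d) ≤ μ (Metric.closedBall (vert 0) d) := hle 2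
  rw [sdens, sdens]
  congr 1
  fin_cases i
  · rfl
  · exact le_antisymm (h1.trans h2) h0
  · exact le_antisymm h2 (h0.trans h1)

theorem specAt_eq_Icc [IsFiniteMeasure μ]
    (hsph : ∀ (z : Plane) (ρ : ℝ), μ (Metric.sphere z ρ) = 0) (s : ℝ) (x : Plane) :
    specAt μ s x = Set.Icc (liminf (sdens μ s x) (𝓝[>] 0)) (limsup (sdens μ s x) (𝓝[>] 0)) :=
  setOf_seq_limits_eq_Icc_liminf_limsup
    ((continuousOn_sdens hsph s).comp (f := fun d => (x, d)) (by fun_prop) fun _ hd => hd)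

/-- The density of a typical ball is attained at arbitrarily small scales on a dense set. -/
theorem attractor_subset_closure_sdens_eq (hSc : IsCompact S) (hSattr : S = ⋃ i, sierf i '' S)
    (hsupp : μ Sᶜ = 0)
    (hinv : μ = (3 : ℝ≥0∞)⁻¹ • (μ.map (sierf 0) + μ.map (sierf 1) + μ.map (sierf 2)))
    {t : ℝ≥0∞} (ht : t ∈ typDens μ S) {r : ℝ} (hr : 0 < r) :
    S ⊆ closure {x | x ∈ S ∧ ∃ d, 0 < d ∧ d < r ∧ sdens μ sierDim x d = t} := by
  obtain ⟨x₀, hx₀, d₀, hd₀, ⟨O, hO, hball⟩, rfl⟩ := ht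
  set t := sdens μ sierDim x₀ d₀
  have hstep : ∀ x ∈ S, ∀ d, 0 < d → Metric.closedBall x d ⊆ O → sdens μ sierDim x d = t →
      ∀ i, sierf i x ∈ S ∧ 0 < d / 2 ∧ Metric.closedBall (sierf i x) (d / 2) ⊆ O ∧
        sdens μ sierDim (sierf i x) (d / 2) = t := fun x hx d hd hb he i =>
    ⟨sierf_mem_attractor hSattr i hx, by positivity, closedBall_sierf_subset (hO.2.2.1 i) hb,
      (sdens_sierf hSc hSattr hsupp hinv hO hd hb i).trans he⟩
  have hiter : ∀ n : ℕ, ∃ x ∈ S, 0 < d₀ * (1 / 2) ^ n ∧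
      Metric.closedBall x (d₀ * (1 / 2) ^ n) ⊆ O ∧ sdens μ sierDim x (d₀ * (1 / 2) ^ n) = t := by
    intro n
    induction n with
    | zero => exact ⟨x₀, hx₀, by simpa using ⟨hd₀, hball, rfl⟩⟩
    | succ n ih =>
      obtain ⟨x, hx, hd, hb, he⟩ := ih
      refine ⟨sierf 0 x, ?_⟩
      rw [show d₀ * (1 / 2) ^ (n + 1) = d₀ * (1 / 2) ^ n / 2 by ring]
      exact hstep x hx _ hd hb he 0
  have hlim : Tendsto (fun n : ℕ => d₀ * (1 / 2 : ℝ) ^ n) atTop (𝓝 (d₀ * 0)) :=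
    (tendsto_pow_atTop_nhds_zero_of_lt_one (by norm_num) (by norm_num)).const_mul d₀
  rw [mul_zero] at hlim
  obtain ⟨n, hn⟩ := (hlim.eventually_lt_const hr).exists
  obtain ⟨x, hx, hd, hb, he⟩ := hiter n
  refine (attractor_subset_closure hSc hSattr
    (A := {x | x ∈ S ∧ ∃ d, 0 < d ∧ d < r ∧ Metric.closedBall x d ⊆ O ∧ sdens μ sierDim x d = t})
    ⟨x, hx, _, hd, hn, hb, he⟩ ?_).trans
    (closure_mono fun y ⟨hy, d, hd, hdr, _, he⟩ => ⟨hy, d, hd, hdr, he⟩)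
  rintro i y ⟨hy, d, hd, hdr, hb, he⟩
  obtain ⟨h1, h2, h3, h4⟩ := hstep y hy d hd hb he i
  exact ⟨h1, _, h2, by linarith, h3, h4⟩

theorem eventually_residual_frequently_sdens_mem [IsFiniteMeasure μ] (hSc : IsCompact S)
    (hSattr : S = ⋃ i, sierf i '' S) (hsupp : μ Sᶜ = 0)
    (hinv : μ = (3 : ℝ≥0∞)⁻¹ • (μ.map (sierf 0) + μ.map (sierf 1) + μ.map (sierf 2)))
    (hsph : ∀ (z : Plane) (ρ : ℝ), μ (Metric.sphere z ρ) = 0)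
    {t : ℝ≥0∞} (ht : t ∈ typDens μ S) {U : Set ℝ≥0∞} (hU : U ∈ 𝓝 t) :
    ∀ᶠ x : S in residual S, ∃ᶠ d in 𝓝[>] (0 : ℝ), sdens μ sierDim x d ∈ U := by
  wlog hUo : IsOpen U generalizing U
  · obtain ⟨V, hVU, hVo, htV⟩ := mem_nhds_iff.1 hU
    exact (this (hVo.mem_nhds htV) hVo).mono fun x hx => hx.mono fun d hd => hVU hd
  have hgen : ∀ n : ℕ, ∀ᶠ x : S in residual S,
      ∃ d, 0 < d ∧ d < 1 / ((n : ℝ) + 1) ∧ sdens μ sierDim x d ∈ U := by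
    intro n
    refine residual_of_dense_open ?_ ?_
    · have : {x : S | ∃ d, 0 < d ∧ d < 1 / ((n : ℝ) + 1) ∧ sdens μ sierDim x d ∈ U} =
          ⋃ d ∈ Set.Ioo 0 (1 / ((n : ℝ) + 1)), (fun x : S => sdens μ sierDim x d) ⁻¹' U := by
        ext x; simp [and_assoc]
      rw [this]
      refine isOpen_biUnion fun d hd => hUo.preimage ?_
      exact (continuousOn_sdens hsph sierDim).comp_continuous (f := fun x : S => ((x : Plane), d))
        (by fun_prop) fun _ => hd.1
    · intro x
      rw [closure_subtype]
      refine closure_mono ?_ (attractor_subset_closure_sdens_eq hSc hSattr hsupp hinv ht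
        (Nat.one_div_pos_of_nat (n := n)) x.2)
      rintro y ⟨hy, d, hd, hdn, rfl⟩
      exact ⟨⟨y, hy⟩, ⟨d, hd, hdn, mem_of_mem_nhds hU⟩, rfl⟩
  filter_upwards [eventually_countable_forall.2 hgen] with x hx
  rw [frequently_iff]
  intro V hV
  obtain ⟨ε, hε, hεV⟩ := mem_nhdsGT_iff_exists_Ioo_subset.1 hV
  obtain ⟨n, hn⟩ := exists_nat_one_div_lt (show (0 : ℝ) < ε from hε)
  obtain ⟨d, hd, hdn, hdU⟩ := hx n
  exact ⟨d, hεV ⟨hd, hdn.trans hn⟩, hdU⟩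

/-- The density of a typical ball belongs to the spectrum at topologically generic points. -/
theorem eventually_residual_mem_specAt [IsFiniteMeasure μ] (hSc : IsCompact S)
    (hSattr : S = ⋃ i, sierf i '' S) (hsupp : μ Sᶜ = 0)
    (hinv : μ = (3 : ℝ≥0∞)⁻¹ • (μ.map (sierf 0) + μ.map (sierf 1) + μ.map (sierf 2)))
    (hsph : ∀ (z : Plane) (ρ : ℝ), μ (Metric.sphere z ρ) = 0)
    {t : ℝ≥0∞} (ht : t ∈ typDens μ S) :
    ∀ᶠ x : S in residual S, t ∈ specAt μ sierDim x := by
  obtain ⟨U, hU⟩ := (𝓝 t).exists_antitone_basis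
  filter_upwards [eventually_countable_forall.2 fun n =>
    eventually_residual_frequently_sdens_mem hSc hSattr hsupp hinv hsph ht (hU.mem n)] with x hx
  refine exists_seq_tendsto_of_frequently fun V hV => ?_
  obtain ⟨n, hn⟩ := hU.mem_iff.1 hV
  exact (hx n).mono fun d hd => hn hd

/-- At points other than the vertices all small balls are typical. -/
theorem eventually_sdens_mem_typDens (hSc : IsCompact S) (hSattr : S = ⋃ i, sierf i '' S)
    {x : Plane} (hx : x ∈ S) (hv : ∀ i, x ≠ vert i) :
    ∀ᶠ d in 𝓝[>] (0 : ℝ), sdens μ sierDim x d ∈ typDens μ S := by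
  have hmem := mem_hexagon_of_ne_vert hSc hSattr hx hv
  obtain ⟨ε, hε, hball⟩ := Metric.isOpen_iff.1 isOpen_hexagon x hmem
  filter_upwards [Ioo_mem_nhdsGT hε] with d hd
  exact ⟨x, hx, d, hd.1, ⟨hexagon, feasibleFor_hexagon ⟨x, hmem, hx⟩,
    (Metric.closedBall_subset_ball hd.2).trans hball⟩, rfl⟩

end Measure

/-- writing `m = inf` and `M = sup` of the densities of typical balls of
the Sierpinski gasket `S` (both attained), the full asymptotic spectrum is
`Spec(μ, S) = [θ̲_μ^s(z₀), θ̄_μ^s(z₀)] ∪ [m, M]`. -/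
theorem stmt17
    (S : Set (EuclideanSpace ℝ (Fin 2))) (hSc : IsCompact S) (hSne : S.Nonempty)
    (hSattr : S = ⋃ i, sierf i '' S)
    (μ : Measure (EuclideanSpace ℝ (Fin 2))) (hprob : IsProbabilityMeasure μ)
    (hsupp : μ Sᶜ = 0)
    (hinv : μ = (3 : ℝ≥0∞)⁻¹ • (μ.map (sierf 0) + μ.map (sierf 1) + μ.map (sierf 2)))
    (hsph : ∀ (z : EuclideanSpace ℝ (Fin 2)) (ρ : ℝ), μ (Metric.sphere z ρ) = 0)
    (hfront : ∀ O, feasibleFor S O → μ (frontier O) = 0)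
    (hinfmem : sInf (typDens μ S) ∈ typDens μ S)
    (hsupmem : sSup (typDens μ S) ∈ typDens μ S) :
    (⋃ x ∈ S, specAt μ sierDim x) =
      Set.Icc
        (Filter.liminf (fun d => sdens μ sierDim (vert 0) d) (nhdsWithin 0 (Set.Ioi 0)))
        (Filter.limsup (fun d => sdens μ sierDim (vert 0) d) (nhdsWithin 0 (Set.Ioi 0)))
      ∪ Set.Icc (sInf (typDens μ S)) (sSup (typDens μ S)) := by
  have := hprob
  apply Set.Subset.antisymm
  · refine Set.iUnion₂_subset fun x hx => ?_
    rw [specAt_eq_Icc hsph]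
    by_cases hv : ∃ i, x = vert i
    · obtain ⟨i, rfl⟩ := hv
      rw [funext (sdens_vert hSc hsupp hinv hsph sierDim i)]
      exact Set.subset_union_left
    · push Not at hv
      have htyp := eventually_sdens_mem_typDens (μ := μ) hSc hSattr hx hv
      exact (Set.Icc_subset_Icc
        (le_liminf_of_le (by isBoundedDefault) (htyp.mono fun d hd => sInf_le hd))
        (limsup_le_of_le (by isBoundedDefault) (htyp.mono fun d hd => le_sSup hd))).trans
        Set.subset_union_right
  · refine Set.union_subset ?_ ?_
    · rw [← specAt_eq_Icc hsph sierDim (vert 0)]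
      exact Set.subset_biUnion_of_mem (vert_zero_mem_attractor hSc hSne hSattr)
    · have : CompactSpace S := isCompact_iff_compactSpace.1 hSc
      have : Nonempty S := hSne.to_subtype
      obtain ⟨x, hxm, hxM⟩ := (dense_of_mem_residual
        ((eventually_residual_mem_specAt hSc hSattr hsupp hinv hsph hinfmem).and
          (eventually_residual_mem_specAt hSc hSattr hsupp hinv hsph hsupmem))).nonempty
      refine Set.Subset.trans ?_ (Set.subset_biUnion_of_mem x.2)
      rw [specAt_eq_Icc hsph] at hxm hxM ⊢
      exact Set.Icc_subset_Icc hxm.1 hxM.2
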